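/- Let T be a bounded open convex polygon in ℝ². If u is a polynomial of degree at most k+2 on T whose L² projection onto P_k(T) is zero and whose L² projection onto P_{k+1}(e) is zero for every edge e of ∂T, then u = 0. -/

import Mathlib

open MeasureTheory MvPolynomial

/-- Euclidean length of a vector in `Fin 2 → ℝ`. -/
noncomputable def elen (v : Fin 2 → ℝ) : ℝ := Real.sqrt (∑ i, v i ^ 2)

/-- A bounded open convex polygon in the plane. Each edge is recorded as a triple
`(a, b, n)` where the edge is the segment from `a` to `b` and `n` is the outward
unit normal on that edge. -/
structure ConvexPolygon2 where
  T : Set (Fin 2 → ℝ)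
  edges : Finset ((Fin 2 → ℝ) × (Fin 2 → ℝ) × (Fin 2 → ℝ))
  open_T : IsOpen T
  convex_T : Convex ℝ T
  bounded_T : Bornology.IsBounded T
  nonempty_T : T.Nonempty
  frontier_eq : frontier T = ⋃ e ∈ edges, segment ℝ e.1 e.2.1
  edge_ne : ∀ e ∈ edges, e.1 ≠ e.2.1
  normal_unit : ∀ e ∈ edges, ∑ i, e.2.2 i ^ 2 = 1
  normal_orth : ∀ e ∈ edges, ∑ i, e.2.2 i * (e.2.1 i - e.1 i) = 0
  normal_outward : ∀ e ∈ edges, ∀ x ∈ T, ∑ i, e.2.2 i * (x i - e.1 i) ≤ 0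

/-- Point on an edge at parameter `t ∈ [0,1]`. -/
noncomputable def edgePt (e : (Fin 2 → ℝ) × (Fin 2 → ℝ) × (Fin 2 → ℝ)) (t : ℝ) :
    Fin 2 → ℝ := e.1 + t • (e.2.1 - e.1)

/-- Integral of a scalar function over an edge (with respect to arclength),
computed via the affine parametrization of the segment. -/
noncomputable def edgeInt (e : (Fin 2 → ℝ) × (Fin 2 → ℝ) × (Fin 2 → ℝ))
    (f : (Fin 2 → ℝ) → ℝ) : ℝ :=
  elen (e.2.1 - e.1) * ∫ t in (0:ℝ)..1, f (edgePt e t)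

theorem self_orth {a b : ℝ} (hab : a < b) (p : Polynomial ℝ)
    (h : ∫ x in a..b, p.eval x * p.eval x = 0) : p = 0 := by
  by_contra hp
  have hc : Continuous fun x => p.eval x * p.eval x := by fun_prop
  have : ∃ c ∈ Set.Icc a b, p.eval c ≠ 0 := by
    by_contra! hh
    exact hp (Polynomial.eq_zero_of_infinite_isRoot p
      ((Set.Icc_infinite hab).mono fun x hx => hh x hx))
  obtain ⟨c, hc1, hc2⟩ := this
  have := intervalIntegral.integral_pos hab hc.continuousOn (fun x _ => mul_self_nonneg _)
    ⟨c, hc1, mul_self_pos.2 hc2⟩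
  linarith

theorem orth_unique (k : ℕ) {α β γ δ : ℝ} (hαβ : α < β) (hγδ : γ < δ) (p : Polynomial ℝ)
    (hp : p.natDegree ≤ k + 2)
    (H1 : ∀ q : Polynomial ℝ, q.natDegree ≤ k + 1 → ∫ x in α..β, p.eval x * q.eval x = 0)
    (H2 : ∀ q : Polynomial ℝ, q.natDegree ≤ k + 1 → ∫ x in γ..δ, p.eval x * q.eval x = 0)
    (hne : (α, β) ≠ (γ, δ)) : p = 0 := by
  obtain ⟨s, hs⟩ : ∃ s, s = (δ - γ) / (β - α) := ⟨_, rfl⟩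
  obtain ⟨r, hr⟩ : ∃ r, r = γ - s * α := ⟨_, rfl⟩
  have hba : 0 < β - α := by linarith
  have hs0 : 0 < s := by rw [hs]; exact div_pos (by linarith) hba
  have hsδ : s * β + r = δ := by
    have : s * (β - α) = δ - γ := by rw [hs]; field_simp
    rw [hr]; linarith
  have hsγ : s * α + r = γ := by rw [hr]; ring
  obtain ⟨φ, hφ⟩ : ∃ φ : Polynomial ℝ, φ = Polynomial.C s * Polynomial.X + Polynomial.C r := ⟨_, rfl⟩
  have hφd : φ.natDegree = 1 := by rw [hφ]; exact Polynomial.natDegree_linear hs0.ne'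
  have hφl : φ.leadingCoeff = s := by rw [hφ]; exact Polynomial.leadingCoeff_linear hs0.ne'
  obtain ⟨d, hd⟩ : ∃ d : Polynomial ℝ, d = p.comp φ - Polynomial.C (s ^ (k+2)) * p := ⟨_, rfl⟩
  have hcd : (p.comp φ).natDegree ≤ k + 2 := by
    rw [Polynomial.natDegree_comp, hφd]; omega
  have hdd : d.natDegree ≤ k + 2 := by
    rw [hd]
    exact (Polynomial.natDegree_sub_le _ _).trans (max_le hcd
      ((Polynomial.natDegree_C_mul_le _ _).trans hp))
  have hdc : d.coeff (k+2) = 0 := by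
    rw [hd, Polynomial.coeff_sub, Polynomial.coeff_C_mul]
    rcases hp.lt_or_eq with h | h
    · rw [Polynomial.coeff_eq_zero_of_natDegree_lt h, Polynomial.coeff_eq_zero_of_natDegree_lt]
      · simp
      · rw [Polynomial.natDegree_comp, hφd]; omega
    · have := Polynomial.coeff_comp_degree_mul_degree (p := p) (q := φ) (by rw [hφd]; norm_num)
      rw [hφd, mul_one, hφl, h, Polynomial.leadingCoeff, h] at this
      rw [this]; ring
  have hdd' : d.natDegree ≤ k + 1 := by
    rcases hdd.lt_or_eq with h | h
    · omega
    · rw [← h] at hdc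
      have : d = 0 := by rwa [← Polynomial.leadingCoeff_eq_zero]
      simp [this]
  have hdorth : ∀ q : Polynomial ℝ, q.natDegree ≤ k + 1 →
      ∫ x in α..β, d.eval x * q.eval x = 0 := by
    intro q hq
    have h2 : ∫ x in α..β, (p.comp φ).eval x * q.eval x = 0 := by
      obtain ⟨q', hq'⟩ : ∃ q' : Polynomial ℝ, q' = q.comp (Polynomial.C s⁻¹ * Polynomial.X + Polynomial.C (-(s⁻¹ * r))) := ⟨_, rfl⟩
      have hqd : q'.natDegree ≤ k + 1 := by
        rw [hq', Polynomial.natDegree_comp]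
        rw [Polynomial.natDegree_linear (inv_ne_zero hs0.ne')]; omega
      have := intervalIntegral.integral_comp_mul_add (a := α) (b := β) (fun y => p.eval y * q'.eval y) hs0.ne' r
      rw [hsδ, hsγ, H2 q' hqd, smul_zero] at this
      rw [← this]
      congr 1; ext x
      simp only [hq', hφ, Polynomial.eval_comp]
      simp only [Polynomial.eval_add, Polynomial.eval_mul, Polynomial.eval_C, Polynomial.eval_X]
      congr 2
      field_simp; ring
    have h1 := H1 q hq
    have : (fun x => d.eval x * q.eval x) = fun x => (p.comp φ).eval x * q.eval x - s^(k+2) * (p.eval x * q.eval x) := by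
      ext x; rw [hd]; simp only [Polynomial.eval_sub, Polynomial.eval_mul, Polynomial.eval_C]; ring
    rw [this, intervalIntegral.integral_sub, h2, intervalIntegral.integral_const_mul, h1]
    · simp
    · exact Continuous.intervalIntegrable (by fun_prop) _ _
    · exact Continuous.intervalIntegrable (by fun_prop) _ _
  have hd0 : d = 0 := self_orth hαβ d (hdorth d hdd')
  have key : ∀ x, p.eval (s * x + r) = s ^ (k+2) * p.eval x := by
    intro x
    have : d.eval x = 0 := by simp [hd0]
    rw [hd, hφ] at this
    simp only [Polynomial.eval_sub, Polynomial.eval_comp, Polynomial.eval_mul, Polynomial.eval_C, Polynomial.eval_add, Polynomial.eval_X] at this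
    linarith
  by_cases h1 : s = 1
  · have hr0 : r ≠ 0 := by
      rintro h0
      rw [h1, h0] at hsδ hsγ
      apply hne
      simp only [Prod.mk.injEq]; constructor <;> linarith
    have hj : ∀ j : ℕ, p.eval (j * r) = p.eval 0 := by
      intro j
      induction j with
      | zero => simp
      | succ j ih =>
        rw [← ih]; have := key (j * r); rw [h1] at this
        push_cast; rw [show ((j:ℝ) + 1) * r = 1 * (j * r) + r by ring, this]; simp
    have hpc : p - Polynomial.C (p.eval 0) = 0 := by
      apply Polynomial.eq_zero_of_infinite_isRoot
      apply Set.Infinite.mono (s := Set.range fun j : ℕ => (j:ℝ) * r)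
      · rintro _ ⟨j, rfl⟩
        simp [hj]
      · apply Set.infinite_range_of_injective
        intro i j hij
        simpa [hr0] using hij
    have hpc' : p = Polynomial.C (p.eval 0) := by linear_combination hpc
    have := H1 p (by rw [hpc']; simp)
    exact self_orth hαβ p this
  · obtain ⟨m, hm⟩ : ∃ m, m = r / (1 - s) := ⟨_, rfl⟩
    have h1s : 1 - s ≠ 0 := fun h => h1 (by linarith)
    have hmr : s * m + r = m := by rw [hm]; field_simp; ring
    obtain ⟨Q, hQ⟩ : ∃ Q : Polynomial ℝ, Q = p.comp (Polynomial.X + Polynomial.C m) := ⟨_, rfl⟩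
    have hQe : Q.comp (Polynomial.C s * Polynomial.X) = Polynomial.C (s ^ (k+2)) * Q := by
      apply Polynomial.funext
      intro y
      rw [hQ]
      simp only [Polynomial.eval_comp, Polynomial.eval_mul, Polynomial.eval_C, Polynomial.eval_add, Polynomial.eval_X]
      rw [← key]; congr 1; linear_combination -hmr
    have hQc : ∀ j, j ≠ k + 2 → Q.coeff j = 0 := by
      intro j hj
      have := congrArg (fun P => Polynomial.coeff P j) hQe
      simp only [Polynomial.comp_C_mul_X_coeff, Polynomial.coeff_C_mul] at this
      by_contra h
      apply hj
      apply pow_right_injective₀ hs0 h1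
      simp only
      apply mul_left_cancel₀ h
      linarith
    have hQf : Q = Polynomial.C (Q.coeff (k+2)) * Polynomial.X ^ (k+2) := by
      ext j
      rw [Polynomial.coeff_C_mul_X_pow]
      split_ifs with h
      · rw [h]
      · exact hQc j h
    obtain ⟨c, hc⟩ : ∃ c, c = Q.coeff (k+2) := ⟨_, rfl⟩
    rw [← hc] at hQf
    have hpf : ∀ x, p.eval x = c * (x - m) ^ (k+2) := by
      intro x
      have : Q.eval (x - m) = c * (x - m) ^ (k+2) := by rw [hQf]; simp
      rw [← this, hQ]; simp
    have h0 := H1 (Polynomial.C c * (Polynomial.X - Polynomial.C m) ^ k) (by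
      refine (Polynomial.natDegree_C_mul_le _ _).trans ?_
      rw [Polynomial.natDegree_pow, Polynomial.natDegree_X_sub_C]; omega)
    have := self_orth hαβ (Polynomial.C c * (Polynomial.X - Polynomial.C m) ^ (k+1)) (by
      rw [← h0]; congr 1; ext x; rw [hpf]; simp; ring)
    have hc0 : c = 0 := by
      rw [mul_eq_zero] at this
      rcases this with h | h
      · simpa using h
      · exact absurd h (pow_ne_zero _ (Polynomial.X_sub_C_ne_zero m))
    apply Polynomial.funext
    intro x; rw [hpf, hc0]; simp

theorem cover_int {ι : Type*} (k : ℕ) (A : Set ℝ) (U W : ℝ → ℝ) (hA : MeasurableSet A)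
    (E : Finset ι) (α β : ι → ℝ) (p w : ι → Polynomial ℝ)
    (hlt : ∀ e ∈ E, α e < β e) (hsub : ∀ e ∈ E, Set.Ioo (α e) (β e) ⊆ A)
    (hcov : ∀ x ∈ A, ∃ e ∈ E, x ∈ Set.Icc (α e) (β e))
    (hU : ∀ e ∈ E, ∀ x ∈ Set.Ioo (α e) (β e), U x = (p e).eval x)
    (hW : ∀ e ∈ E, ∀ x ∈ Set.Ioo (α e) (β e), W x = (w e).eval x)
    (hp : ∀ e ∈ E, (p e).natDegree ≤ k + 2) (hw : ∀ e ∈ E, (w e).natDegree ≤ k + 1)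
    (horth : ∀ e ∈ E, ∀ q : Polynomial ℝ, q.natDegree ≤ k + 1 →
      ∫ x in (α e)..(β e), (p e).eval x * q.eval x = 0) :
    IntegrableOn (fun x => U x * W x) A ∧ ∫ x in A, U x * W x = 0 := by
  classical
  set F : ℝ → ℝ := fun x => U x * W x with hF
  let G : Finset (ℝ × ℝ) := (E.filter (fun e => p e ≠ 0)).image (fun e => (α e, β e))
  have hG : ∀ I ∈ G, ∃ e ∈ E, p e ≠ 0 ∧ (α e, β e) = I := by
    intro I hI
    simp only [G, Finset.mem_image, Finset.mem_filter] at hI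
    obtain ⟨e, ⟨h1, h2⟩, h3⟩ := hI
    exact ⟨e, h1, h2, h3⟩
  have heq : ∀ e ∈ E, ∀ e' ∈ E, ∀ x, x ∈ Set.Ioo (α e) (β e) → x ∈ Set.Ioo (α e') (β e') →
      p e = p e' := by
    intro e he e' he' x hx hx'
    apply Polynomial.eq_of_infinite_eval_eq
    have : (Set.Ioo (max (α e) (α e')) (min (β e) (β e'))).Infinite := by
      apply Set.Ioo_infinite
      exact (max_lt hx.1 hx'.1).trans (lt_min hx.2 hx'.2)
    apply this.mono
    intro y hy
    have h1 : y ∈ Set.Ioo (α e) (β e) :=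
      ⟨(le_max_left _ _).trans_lt hy.1, hy.2.trans_le (min_le_left _ _)⟩
    have h2 : y ∈ Set.Ioo (α e') (β e') :=
      ⟨(le_max_right _ _).trans_lt hy.1, hy.2.trans_le (min_le_right _ _)⟩
    show (p e).eval y = (p e').eval y
    rw [← hU e he y h1, hU e' he' y h2]
  have hintg : ∀ e ∈ E, IntegrableOn F (Set.Ioo (α e) (β e)) := by
    intro e he
    have h1 : IntegrableOn (fun x => (p e).eval x * (w e).eval x) (Set.Ioo (α e) (β e)) :=
      (Continuous.integrableOn_Icc (by fun_prop)).mono_set Set.Ioo_subset_Icc_self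
    refine h1.congr_fun (fun x hx => ?_) measurableSet_Ioo
    simp only [hF]; rw [hU e he x hx, hW e he x hx]
  have hzero : ∀ e ∈ E, ∫ x in Set.Ioo (α e) (β e), F x = 0 := by
    intro e he
    have h1 : ∫ x in Set.Ioo (α e) (β e), F x
        = ∫ x in Set.Ioo (α e) (β e), (p e).eval x * (w e).eval x := by
      apply setIntegral_congr_fun measurableSet_Ioo
      intro x hx
      simp only [hF]; rw [hU e he x hx, hW e he x hx]
    rw [h1, ← integral_Ioc_eq_integral_Ioo, ← intervalIntegral.integral_of_le (hlt e he).le]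
    exact horth e he _ (hw e he)
  have hae : (A.indicator F) =ᵐ[volume]
      fun x => ∑ I ∈ G, (Set.Ioo I.1 I.2).indicator F x := by
    have hfin : ((E.image α ∪ E.image β : Finset ℝ) : Set ℝ).Finite := Finset.finite_toSet _
    have hn : ∀ᵐ x, x ∉ ((E.image α ∪ E.image β : Finset ℝ) : Set ℝ) :=
      (Set.Finite.measure_zero hfin volume : _) |> measure_eq_zero_iff_ae_notMem.1
    filter_upwards [hn] with x hx
    by_cases hxA : x ∈ A
    · rw [Set.indicator_of_mem hxA]
      obtain ⟨e, he, hxe⟩ := hcov x hxA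
      have hxo : x ∈ Set.Ioo (α e) (β e) := by
        refine ⟨lt_of_le_of_ne hxe.1 ?_, lt_of_le_of_ne hxe.2 ?_⟩
        · rintro h; apply hx; simp only [Finset.coe_union, Finset.coe_image]
          left; exact ⟨e, he, h⟩
        · rintro h; apply hx; simp only [Finset.coe_union, Finset.coe_image]
          right; exact ⟨e, he, h.symm⟩
      by_cases hpe : p e = 0
      · have hF0 : F x = 0 := by simp only [hF]; rw [hU e he x hxo, hpe]; simp
        rw [hF0, Finset.sum_eq_zero]
        intro I _
        by_cases h : x ∈ Set.Ioo I.1 I.2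
        · rw [Set.indicator_of_mem h, hF0]
        · rw [Set.indicator_of_notMem h]
      · rw [Finset.sum_eq_single (α e, β e)]
        · rw [Set.indicator_of_mem hxo]
        · intro I hI hne
          obtain ⟨e', he', hp', rfl⟩ := hG I hI
          apply Set.indicator_of_notMem
          intro hx'
          have hpp := heq e' he' e he x hx' hxo
          apply hpe
          have ho := horth e' he'
          rw [hpp] at ho
          exact orth_unique k (hlt e' he') (hlt e he) (p e) (hp e he) ho (horth e he) hne
        · intro h
          exfalso; apply h
          simp only [G, Finset.mem_image, Finset.mem_filter]
          exact ⟨e, ⟨he, hpe⟩, rfl⟩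
    · rw [Set.indicator_of_notMem hxA, Finset.sum_eq_zero]
      intro I hI
      obtain ⟨e', he', hp', rfl⟩ := hG I hI
      exact Set.indicator_of_notMem (fun h => hxA (hsub e' he' h)) _
  have hI : ∀ I ∈ G, Integrable ((Set.Ioo I.1 I.2).indicator F) := by
    intro I hI
    obtain ⟨e, he, _, rfl⟩ := hG I hI
    exact (integrable_indicator_iff measurableSet_Ioo).2 (hintg e he)
  constructor
  · rw [← integrable_indicator_iff hA]
    exact (integrable_finsetSum G hI).congr hae.symm
  · rw [← integral_indicator hA, integral_congr_ae hae, integral_finsetSum G hI]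
    apply Finset.sum_eq_zero
    intro I hI
    obtain ⟨e, he, _, rfl⟩ := hG I hI
    rw [integral_indicator measurableSet_Ioo]
    exact hzero e he

theorem side_int {ι : Type*} (k : ℕ) (S : Set (ℝ × ℝ)) (hopen : IsOpen S) (hconv : Convex ℝ S)
    (hnonempty : S.Nonempty)
    (E : Finset ι) (a b n : ι → ℝ × ℝ) (pu pw : ι → Polynomial ℝ) (U W : ℝ × ℝ → ℝ)
    (hfr : ∀ z ∈ frontier S, ∃ e ∈ E, ∃ t ∈ Set.Icc (0:ℝ) 1, z = a e + t • (b e - a e))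
    (hfr2 : ∀ e ∈ E, ∀ t ∈ Set.Icc (0:ℝ) 1, a e + t • (b e - a e) ∈ closure S)
    (hne : ∀ e ∈ E, a e ≠ b e)
    (hno : ∀ e ∈ E, (n e).1 * ((b e).1 - (a e).1) + (n e).2 * ((b e).2 - (a e).2) = 0)
    (hstrict : ∀ e ∈ E, ∀ z ∈ S, (n e).1 * (z.1 - (a e).1) + (n e).2 * (z.2 - (a e).2) < 0)
    (hU : ∀ e ∈ E, ∀ t, U (a e + t • (b e - a e)) = (pu e).eval t)
    (hW : ∀ e ∈ E, ∀ t, W (a e + t • (b e - a e)) = (pw e).eval t)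
    (hpu : ∀ e ∈ E, (pu e).natDegree ≤ k + 2) (hpw : ∀ e ∈ E, (pw e).natDegree ≤ k + 1)
    (horth : ∀ e ∈ E, ∀ q : Polynomial ℝ, q.natDegree ≤ k + 1 →
      ∫ x in (0:ℝ)..1, (pu e).eval x * q.eval x = 0)
    (h : ℝ → ℝ) (σ : ℝ)
    (hh1 : ∀ x ∈ Prod.fst '' S, (x, h x) ∈ frontier S)
    (hh2 : ∀ z ∈ S, 0 < σ * (h z.1 - z.2))
    (hh3 : ∀ z ∈ closure S, z.1 ∈ Prod.fst '' S → 0 ≤ σ * (h z.1 - z.2)) :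
    IntegrableOn (fun x => U (x, h x) * W (x, h x)) (Prod.fst '' S) ∧
      ∫ x in Prod.fst '' S, U (x, h x) * W (x, h x) = 0 := by
  classical
  have hAo : IsOpen (Prod.fst '' S) := isOpenMap_fst S hopen
  have hAc : Convex ℝ (Prod.fst '' S) := hconv.linear_image (LinearMap.fst ℝ ℝ ℝ)
  have hcl : ∀ e ∈ E, ∀ z ∈ closure S,
      (n e).1 * (z.1 - (a e).1) + (n e).2 * (z.2 - (a e).2) ≤ 0 := by
    intro e he z hz
    have hc : IsClosed {z : ℝ × ℝ | (n e).1 * (z.1 - (a e).1) + (n e).2 * (z.2 - (a e).2) ≤ 0} :=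
      isClosed_le (by fun_prop) continuous_const
    exact closure_minimal (fun z hz => (hstrict e he z hz).le) hc hz
  let c : ι → ℝ := fun e => ((b e).1 - (a e).1)⁻¹
  let L : ι → Polynomial ℝ := fun e =>
    Polynomial.C (c e) * Polynomial.X + Polynomial.C (-(c e * (a e).1))
  have hab : ∀ e ∈ E, 0 < σ * (n e).2 → (a e).1 ≠ (b e).1 := by
    intro e he hs heq
    apply hne e he
    have h1 := hno e he
    rw [heq] at h1
    have h2 : (n e).2 ≠ 0 := by rintro h0; rw [h0] at hs; simp at hs
    have h3 : (n e).2 * ((b e).2 - (a e).2) = 0 := by linarith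
    have h4 : (b e).2 - (a e).2 = 0 := (mul_eq_zero.1 h3).resolve_left h2
    exact Prod.ext heq (by linarith)
  have hLe : ∀ e x, (L e).eval x = c e * (x - (a e).1) := by
    intro e x; simp only [L]; simp; ring
  have hLd : ∀ e, (L e).natDegree ≤ 1 := fun e => Polynomial.natDegree_linear_le
  have hpar : ∀ e ∈ E, 0 < σ * (n e).2 → ∀ x ∈ Set.Ioo (min (a e).1 (b e).1) (max (a e).1 (b e).1),
      (L e).eval x ∈ Set.Icc (0:ℝ) 1 ∧
        (a e).1 + (L e).eval x * ((b e).1 - (a e).1) = x := by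
    intro e he hs x hx
    have hne' := hab e he hs
    rw [hLe]
    have hd : (b e).1 - (a e).1 ≠ 0 := fun h => hne' (by linarith)
    refine ⟨?_, by simp only [c]; field_simp; ring⟩
    simp only [c]
    rw [inv_mul_eq_div]
    rcases lt_or_gt_of_ne hne' with hl | hl
    · rw [min_eq_left hl.le, max_eq_right hl.le] at hx
      have : 0 < (b e).1 - (a e).1 := by linarith
      exact ⟨div_nonneg (by linarith [hx.1]) this.le, (div_le_one this).2 (by linarith [hx.2])⟩
    · rw [min_eq_right hl.le, max_eq_left hl.le] at hx
      have : (b e).1 - (a e).1 < 0 := by linarith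
      exact ⟨div_nonneg_of_nonpos (by linarith [hx.2]) this.le,
        (div_le_one_of_neg this).2 (by linarith [hx.1])⟩
  have hsub : ∀ e ∈ E, 0 < σ * (n e).2 →
      Set.Ioo (min (a e).1 (b e).1) (max (a e).1 (b e).1) ⊆ Prod.fst '' S := by
    intro e he hs
    have h1 : Set.Ioo (min (a e).1 (b e).1) (max (a e).1 (b e).1) ⊆ closure (Prod.fst '' S) := by
      intro x hx
      obtain ⟨ht, hx2⟩ := hpar e he hs x hx
      have := hfr2 e he _ ht
      apply image_closure_subset_closure_image continuous_fst
      refine ⟨_, this, ?_⟩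
      simpa using hx2
    have h2 := interior_maximal h1 isOpen_Ioo
    rwa [hAc.interior_closure_eq_interior_of_nonempty_interior (by
      rw [hAo.interior_eq]; exact hnonempty.image _), hAo.interior_eq] at h2
  have hgr : ∀ e ∈ E, 0 < σ * (n e).2 →
      ∀ x ∈ Set.Ioo (min (a e).1 (b e).1) (max (a e).1 (b e).1),
      (x, h x) = a e + (L e).eval x • (b e - a e) := by
    intro e he hs x hx
    obtain ⟨ht, hx2⟩ := hpar e he hs x hx
    have hxA := hsub e he hs hx
    have hz := hfr2 e he _ ht
    obtain ⟨t, htt⟩ : ∃ t, t = (L e).eval x := ⟨_, rfl⟩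
    rw [← htt] at hx2 hz ⊢
    have h3 := hh3 _ hz (by simpa [hx2] using hxA)
    simp only [Prod.fst_add, Prod.smul_fst, Prod.fst_sub, Prod.snd_add, Prod.smul_snd, Prod.snd_sub,
      smul_eq_mul, hx2] at h3
    have h4 := hcl e he _ (frontier_subset_closure (hh1 x hxA))
    simp only at h4
    have h5 := hno e he
    obtain ⟨z, hz'⟩ : ∃ z, z = (a e).2 + t * ((b e).2 - (a e).2) := ⟨_, rfl⟩
    rw [← hz'] at h3
    have h6 : (n e).2 * (h x - z) ≤ 0 := by
      have : (n e).1 * (x - (a e).1) + (n e).2 * (h x - (a e).2) = (n e).2 * (h x - z) := by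
        rw [← hx2, hz']; rw [hx2]; linear_combination t * h5 - (n e).1 * hx2
      linarith
    have h7 : h x = z := by
      by_contra hc
      have h8 : 0 < (h x - z)^2 := by
        have : h x - z ≠ 0 := sub_ne_zero.2 hc
        positivity
      nlinarith [mul_pos hs h8, mul_nonneg h3 (neg_nonneg.2 h6)]
    ext
    · simp [hx2]
    · simp [h7, hz']
  refine cover_int k (Prod.fst '' S) (fun x => U (x, h x)) (fun x => W (x, h x)) hAo.measurableSet
    (E.filter fun e => 0 < σ * (n e).2) (fun e => min (a e).1 (b e).1) (fun e => max (a e).1 (b e).1)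
    (fun e => (pu e).comp (L e)) (fun e => (pw e).comp (L e)) ?_ ?_ ?_ ?_ ?_ ?_ ?_ ?_
  · intro e he
    rw [Finset.mem_filter] at he
    exact min_lt_max.2 (hab e he.1 he.2)
  · intro e he
    rw [Finset.mem_filter] at he
    exact hsub e he.1 he.2
  · intro x hx
    obtain ⟨e, he, t, ht, hz⟩ := hfr _ (hh1 x hx)
    obtain ⟨⟨x', y⟩, hS, hxx⟩ := hx
    simp only at hxx
    subst hxx
    have e1 : x' = (a e).1 + t * ((b e).1 - (a e).1) := by
      simpa using congrArg Prod.fst hz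
    have e2 : h x' = (a e).2 + t * ((b e).2 - (a e).2) := by
      simpa using congrArg Prod.snd hz
    have h1 := hstrict e he _ hS
    have h2 := hh2 _ hS
    simp only at h1 h2
    have h5 := hno e he
    have h6 : 0 < (n e).2 * (h x' - y) := by
      have : (n e).1 * (x' - (a e).1) + (n e).2 * (y - (a e).2) = - ((n e).2 * (h x' - y)) := by
        rw [e2]; linear_combination t * h5 + (n e).1 * e1
      linarith
    refine ⟨e, Finset.mem_filter.2 ⟨he, ?_⟩, ?_⟩
    · by_contra hc
      push Not at hc
      nlinarith [mul_pos h6 h2, mul_nonneg (neg_nonneg.2 hc) (sq_nonneg (h x' - y))]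
    · obtain ⟨ht0, ht1⟩ := ht
      rcases le_total (a e).1 (b e).1 with hl | hl
      · rw [min_eq_left hl, max_eq_right hl, e1]
        constructor <;> nlinarith
      · rw [min_eq_right hl, max_eq_left hl, e1]
        constructor <;> nlinarith
  · intro e he x hx
    rw [Finset.mem_filter] at he
    rw [hgr e he.1 he.2 x hx, hU e he.1, Polynomial.eval_comp]
  · intro e he x hx
    rw [Finset.mem_filter] at he
    rw [hgr e he.1 he.2 x hx, hW e he.1, Polynomial.eval_comp]
  · intro e he
    rw [Finset.mem_filter] at he
    rw [Polynomial.natDegree_comp]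
    exact (Nat.mul_le_mul (hpu e he.1) (hLd e)).trans (by omega)
  · intro e he
    rw [Finset.mem_filter] at he
    rw [Polynomial.natDegree_comp]
    exact (Nat.mul_le_mul (hpw e he.1) (hLd e)).trans (by omega)
  · intro e he q hq
    rw [Finset.mem_filter] at he
    have hne' := hab e he.1 he.2
    have hd : (b e).1 - (a e).1 ≠ 0 := fun h => hne' (by linarith)
    have hc0 : c e ≠ 0 := inv_ne_zero hd
    have hcd : c e * ((b e).1 - (a e).1) = 1 := inv_mul_cancel₀ hd
    have hmain : ∫ x in (a e).1..(b e).1, ((pu e).comp (L e)).eval x * q.eval x = 0 := by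
      obtain ⟨q', hq'⟩ : ∃ q' : Polynomial ℝ, q' = q.comp
        (Polynomial.C ((b e).1 - (a e).1) * Polynomial.X + Polynomial.C (a e).1) := ⟨_, rfl⟩
      have hqd : q'.natDegree ≤ k + 1 := by
        rw [hq', Polynomial.natDegree_comp]
        exact (Nat.mul_le_mul hq Polynomial.natDegree_linear_le).trans (by omega)
      have := intervalIntegral.integral_comp_mul_add (a := (a e).1) (b := (b e).1)
        (fun y => (pu e).eval y * q'.eval y) hc0 (-(c e * (a e).1))
      rw [show c e * (a e).1 + -(c e * (a e).1) = 0 by ring,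
        show c e * (b e).1 + -(c e * (a e).1) = 1 by linarith, horth e he.1 q' hqd, smul_zero] at this
      rw [← this]
      congr 1; ext x
      rw [Polynomial.eval_comp, hLe, hq', Polynomial.eval_comp]
      congr 2
      · ring
      · simp only [Polynomial.eval_add, Polynomial.eval_mul, Polynomial.eval_C, Polynomial.eval_X]
        linear_combination ((a e).1 - x) * hcd
    rcases le_total (a e).1 (b e).1 with hl | hl
    · rw [min_eq_left hl, max_eq_right hl, hmain]
    · rw [min_eq_right hl, max_eq_left hl, intervalIntegral.integral_symm, hmain, neg_zero]

theorem plane_int {ι : Type*} (k : ℕ) (S : Set (ℝ × ℝ)) (hopen : IsOpen S) (hconv : Convex ℝ S)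
    (hnonempty : S.Nonempty) (hbdd : Bornology.IsBounded S)
    (E : Finset ι) (a b n : ι → ℝ × ℝ) (pu pw : ι → Polynomial ℝ) (U W : ℝ × ℝ → ℝ)
    (hfr : ∀ z ∈ frontier S, ∃ e ∈ E, ∃ t ∈ Set.Icc (0:ℝ) 1, z = a e + t • (b e - a e))
    (hfr2 : ∀ e ∈ E, ∀ t ∈ Set.Icc (0:ℝ) 1, a e + t • (b e - a e) ∈ closure S)
    (hne : ∀ e ∈ E, a e ≠ b e)
    (hno : ∀ e ∈ E, (n e).1 * ((b e).1 - (a e).1) + (n e).2 * ((b e).2 - (a e).2) = 0)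
    (hstrict : ∀ e ∈ E, ∀ z ∈ S, (n e).1 * (z.1 - (a e).1) + (n e).2 * (z.2 - (a e).2) < 0)
    (hU : ∀ e ∈ E, ∀ t, U (a e + t • (b e - a e)) = (pu e).eval t)
    (hW : ∀ e ∈ E, ∀ t, W (a e + t • (b e - a e)) = (pw e).eval t)
    (hpu : ∀ e ∈ E, (pu e).natDegree ≤ k + 2) (hpw : ∀ e ∈ E, (pw e).natDegree ≤ k + 1)
    (horth : ∀ e ∈ E, ∀ q : Polynomial ℝ, q.natDegree ≤ k + 1 →
      ∫ x in (0:ℝ)..1, (pu e).eval x * q.eval x = 0)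
    (G : ℝ × ℝ → ℝ) (hG : Continuous G)
    (hder : ∀ x y, HasDerivAt (fun y => U (x, y) * W (x, y)) (G (x, y)) y) :
    ∫ z in S, G z = 0 := by
  let sl : ℝ → Set ℝ := fun x => {y | (x, y) ∈ S}
  have hcont : ∀ x : ℝ, Continuous fun y : ℝ => (x, y) := fun x => by fun_prop
  have hslo : ∀ x, IsOpen (sl x) := fun x => hopen.preimage (hcont x)
  have hslc : ∀ x, Convex ℝ (sl x) := by
    intro x y hy y' hy' s t hs ht hst
    have := hconv hy hy' hs ht hst
    have e : s • (x, y) + t • (x, y') = (x, s • y + t • y') := by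
      ext
      · simp [← add_mul, hst]
      · simp
    rw [e] at this
    exact this
  have hslb : ∀ x, Bornology.IsBounded (sl x) := by
    intro x
    have : sl x ⊆ Prod.snd '' S := fun y hy => ⟨(x, y), hy, rfl⟩
    exact (LipschitzWith.prod_snd.isBounded_image hbdd).subset this
  have hsln : ∀ x ∈ Prod.fst '' S, (sl x).Nonempty := by
    rintro _ ⟨⟨x, y⟩, hz, rfl⟩
    exact ⟨y, hz⟩
  let h : ℝ → ℝ := fun x => sSup (sl x)
  let g : ℝ → ℝ := fun x => sInf (sl x)
  have hlt : ∀ z ∈ S, g z.1 < z.2 ∧ z.2 < h z.1 := by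
    rintro ⟨x, y⟩ hz
    have hy : y ∈ sl x := hz
    obtain ⟨ε, hε, hb⟩ := Metric.isOpen_iff.1 (hslo x) y hy
    have h1 : y + ε / 2 ∈ sl x := hb (by simp [abs_of_pos hε]; linarith)
    have h2 : y - ε / 2 ∈ sl x := hb (by simp [abs_of_pos hε]; linarith)
    have h3 := le_csSup (hslb x).bddAbove h1
    have h4 := csInf_le (hslb x).bddBelow h2
    simp only [g, h]
    constructor <;> linarith
  have hIoo : ∀ x ∈ Prod.fst '' S, sl x = Set.Ioo (g x) (h x) := by
    intro x hx
    apply Set.Subset.antisymm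
    · intro y hy
      exact hlt (x, y) hy
    · exact IsConnected.Ioo_csInf_csSup_subset ⟨hsln x hx, (hslc x).isPreconnected⟩
        (hslb x).bddBelow (hslb x).bddAbove
  have hcl : ∀ x y, y ∈ closure (sl x) → (x, y) ∈ closure S := by
    intro x y hy
    have := image_closure_subset_closure_image (hcont x) ⟨y, hy, rfl⟩
    exact closure_mono (by rintro _ ⟨y, hy, rfl⟩; exact hy) this
  have hhS : ∀ x ∈ Prod.fst '' S, (x, h x) ∉ S := fun x hx hz => lt_irrefl _ (hlt _ hz).2
  have hgS : ∀ x ∈ Prod.fst '' S, (x, g x) ∉ S := fun x hx hz => lt_irrefl _ (hlt _ hz).1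
  have hh1 : ∀ x ∈ Prod.fst '' S, (x, h x) ∈ frontier S := by
    intro x hx
    rw [hopen.frontier_eq]
    exact ⟨hcl x _ (csSup_mem_closure (hsln x hx) (hslb x).bddAbove), hhS x hx⟩
  have hg1 : ∀ x ∈ Prod.fst '' S, (x, g x) ∈ frontier S := by
    intro x hx
    rw [hopen.frontier_eq]
    exact ⟨hcl x _ (csInf_mem_closure (hsln x hx) (hslb x).bddBelow), hgS x hx⟩
  have hseg : ∀ x y y' w, (x, y) ∈ S → (x, y') ∈ closure S → w ∈ openSegment ℝ y y' →
      (x, w) ∈ S := by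
    intro x y y' w h1 h2 hw
    have := hconv.openSegment_interior_closure_subset_interior (by rwa [hopen.interior_eq]) h2
    rw [hopen.interior_eq] at this
    apply this
    obtain ⟨s, t, hs, ht, hst, rfl⟩ := hw
    refine ⟨s, t, hs, ht, hst, ?_⟩
    ext
    · simp [← add_mul, hst]
    · simp
  have hh3 : ∀ z ∈ closure S, z.1 ∈ Prod.fst '' S → 0 ≤ (1:ℝ) * (h z.1 - z.2) := by
    rintro ⟨x, y'⟩ hz hx
    by_contra hc
    push Not at hc
    simp only at hc hx
    obtain ⟨y, hy⟩ := hsln x hx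
    have h1 := (hlt _ hy).2
    simp only at h1
    apply hhS x hx
    apply hseg x y y' _ hy hz
    rw [openSegment_eq_Ioo (by linarith)]
    exact ⟨h1, by linarith⟩
  have hg3 : ∀ z ∈ closure S, z.1 ∈ Prod.fst '' S → 0 ≤ (-1:ℝ) * (g z.1 - z.2) := by
    rintro ⟨x, y'⟩ hz hx
    by_contra hc
    push Not at hc
    simp only at hc hx
    obtain ⟨y, hy⟩ := hsln x hx
    have h1 := (hlt _ hy).1
    simp only at h1
    apply hgS x hx
    apply hseg x y y' _ hy hz
    rw [openSegment_symm, openSegment_eq_Ioo (by linarith)]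
    exact ⟨by linarith, h1⟩
  obtain ⟨It, Zt⟩ := side_int k S hopen hconv hnonempty E a b n pu pw U W hfr hfr2 hne hno hstrict
    hU hW hpu hpw horth h 1 hh1 (fun z hz => by linarith [(hlt z hz).2]) hh3
  obtain ⟨Ib, Zb⟩ := side_int k S hopen hconv hnonempty E a b n pu pw U W hfr hfr2 hne hno hstrict
    hU hW hpu hpw horth g (-1) hg1 (fun z hz => by linarith [(hlt z hz).1]) hg3
  have hAo : IsOpen (Prod.fst '' S) := isOpenMap_fst S hopen
  have hGi : IntegrableOn G S := by
    have hK : IsCompact (closure S) := hbdd.isCompact_closure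
    exact (hG.continuousOn.integrableOn_compact hK).mono_set subset_closure
  rw [← integral_indicator hopen.measurableSet]
  have hGi' : Integrable (S.indicator G) ((volume : Measure ℝ).prod volume) :=
    (integrable_indicator_iff hopen.measurableSet).2 hGi
  rw [Measure.volume_eq_prod, integral_prod _ hGi']
  have hin : ∀ x, ∫ y, S.indicator G (x, y) = (Prod.fst '' S).indicator
      (fun x => U (x, h x) * W (x, h x) - U (x, g x) * W (x, g x)) x := by
    intro x
    by_cases hx : x ∈ Prod.fst '' S
    · rw [Set.indicator_of_mem hx]
      have e1 : (fun y => S.indicator G (x, y)) = (sl x).indicator fun y => G (x, y) := by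
        ext y
        by_cases hy : (x, y) ∈ S
        · rw [Set.indicator_of_mem hy, Set.indicator_of_mem (show y ∈ sl x from hy)]
        · rw [Set.indicator_of_notMem hy, Set.indicator_of_notMem (show y ∉ sl x from hy)]
      obtain ⟨y, hy⟩ := hsln x hx
      have hgh : g x ≤ h x := ((hlt _ hy).1.trans (hlt _ hy).2).le
      rw [e1, integral_indicator (hslo x).measurableSet, hIoo x hx, ← integral_Ioc_eq_integral_Ioo,
        ← intervalIntegral.integral_of_le hgh]
      exact intervalIntegral.integral_eq_sub_of_hasDerivAt (fun y _ => hder x y)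
        ((hG.comp (hcont x)).intervalIntegrable _ _)
    · rw [Set.indicator_of_notMem hx]
      have e1 : (fun y => S.indicator G (x, y)) = fun _ => 0 := by
        ext y
        exact Set.indicator_of_notMem (fun hy => hx ⟨(x, y), hy, rfl⟩) _
      rw [e1]; simp
  simp_rw [hin]
  rw [integral_indicator hAo.measurableSet, integral_sub It Ib, Zt, Zb, sub_zero]

theorem totalDegree_pderiv_aux (i : Fin 2) (p : MvPolynomial (Fin 2) ℝ) (m : ℕ)
    (hp : p.totalDegree ≤ m + 1) : (pderiv i p).totalDegree ≤ m := by
  rw [totalDegree]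
  apply Finset.sup_le
  intro d hd
  have h1 : d + Finsupp.single i 1 ∈ p.support := by
    rw [mem_support_iff] at hd ⊢
    intro h0
    rw [coeff_pderiv, h0, zero_mul] at hd
    exact hd rfl
  have h2 := (le_totalDegree h1).trans hp
  rw [Finsupp.sum_add_index' (by simp) (by simp), Finsupp.sum_single_index rfl] at h2
  omega

theorem eq_C_of_pderiv (p : MvPolynomial (Fin 2) ℝ) (h : ∀ i, pderiv i p = 0) :
    p = C (p.coeff 0) := by
  ext m
  rw [coeff_C]
  split_ifs with hm
  · rw [hm]
  · obtain ⟨i, hi⟩ : ∃ i, m i ≠ 0 := by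
      by_contra! hc
      exact hm (by ext i; simp [hc i])
    have h1 := coeff_pderiv (i := i) p (m - Finsupp.single i 1)
    rw [h i, coeff_zero, tsub_add_cancel_of_le (by
      rw [Finsupp.single_le_iff]; omega)] at h1
    have h2 : (((m - Finsupp.single i 1 : Fin 2 →₀ ℕ) i : ℝ) + 1) ≠ 0 := by positivity
    exact (mul_eq_zero.1 h1.symm).resolve_right h2

theorem hasDerivAt_eval (i : Fin 2) (p : MvPolynomial (Fin 2) ℝ) (v : ℝ → Fin 2 → ℝ) (y : ℝ)
    (hv : ∀ l, HasDerivAt (fun y => v y l) (if l = i then 1 else 0) y) :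
    HasDerivAt (fun y => eval (v y) p) (eval (v y) (pderiv i p)) y := by
  induction p using MvPolynomial.induction_on with
  | C a => simpa using hasDerivAt_const y a
  | add p q hp hq =>
    simp only [map_add]
    exact hp.add hq
  | mul_X p l hp =>
    have := hp.mul (hv l)
    simp only [pderiv_mul, eval_add, eval_mul, eval_X, pderiv_X]
    refine this.congr_deriv ?_
    congr 2
    by_cases h : l = i
    · subst h; simp
    · simp [h]

theorem eval_aeval_poly (f : Fin 2 → Polynomial ℝ) (p : MvPolynomial (Fin 2) ℝ) (t : ℝ) :
    (aeval f p).eval t = eval (fun l => (f l).eval t) p := by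
  induction p using MvPolynomial.induction_on with
  | C a => simp
  | add p q hp hq => simp [hp, hq]
  | mul_X p l hp => simp [hp]

theorem eq_zero_of_open (T : Set (Fin 2 → ℝ)) (hT : IsOpen T) (hn : T.Nonempty)
    (p : MvPolynomial (Fin 2) ℝ) (h : ∀ x ∈ T, eval x p = 0) : p = 0 := by
  obtain ⟨x, hx⟩ := hn
  obtain ⟨ε, hε, hb⟩ := Metric.isOpen_iff.1 hT x hx
  apply funext_set (fun i => Metric.ball (x i) ε)
  · intro i
    rw [Real.ball_eq_Ioo]
    exact Set.Ioo_infinite (by linarith)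
  · intro y hy
    rw [map_zero]
    apply h _ (hb _)
    rw [ball_pi _ hε]
    exact hy

theorem strict_outward (P : ConvexPolygon2) (e) (he : e ∈ P.edges) (x) (hx : x ∈ P.T) :
    ∑ i, e.2.2 i * (x i - e.1 i) < 0 := by
  have hc : Continuous fun s : ℝ => x + s • e.2.2 := by fun_prop
  have ho := P.open_T.preimage hc
  obtain ⟨ε, hε, hb⟩ := Metric.isOpen_iff.1 ho 0 (by simpa using hx)
  have h1 : x + (ε / 2) • e.2.2 ∈ P.T := hb (by simp [abs_of_pos hε]; linarith)
  have h2 := P.normal_outward e he _ h1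
  have h3 := P.normal_unit e he
  simp only [Fin.sum_univ_two, Pi.add_apply, Pi.smul_apply, smul_eq_mul] at h2 h3 ⊢
  nlinarith

theorem dir_zero (k : ℕ) (P : ConvexPolygon2)
    (u : MvPolynomial (Fin 2) ℝ) (hdeg : u.totalDegree ≤ k + 2)
    (hQ0 : ∀ p : MvPolynomial (Fin 2) ℝ, p.totalDegree ≤ k →
      ∫ x in P.T, eval x u * eval x p = 0)
    (hQb : ∀ e ∈ P.edges, ∀ q : Polynomial ℝ, q.natDegree ≤ k + 1 →
      ∫ t in (0:ℝ)..1, eval (edgePt e t) u * q.eval t = 0)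
    (i j : Fin 2) (hij : ∀ f : Fin 2 → ℝ, ∑ l, f l = f j + f i) (hne : ∀ l, l ≠ i → l = j)
    (hji : j ≠ i)
    (M : (ℝ × ℝ) ≃L[ℝ] (Fin 2 → ℝ)) (hM : MeasurePreserving M)
    (hMi : ∀ z, M z i = z.2) (hMj : ∀ z, M z j = z.1) : pderiv i u = 0 := by
  have hs1 : ∀ x, (M.symm x).1 = x j := fun x => by rw [← hMj, M.apply_symm_apply]
  have hs2 : ∀ x, (M.symm x).2 = x i := fun x => by rw [← hMi, M.apply_symm_apply]
  have hd1 : (pderiv i u).totalDegree ≤ k + 1 := totalDegree_pderiv_aux i u _ hdeg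
  have hd2 : (pderiv i (pderiv i u)).totalDegree ≤ k := totalDegree_pderiv_aux i _ _ hd1
  have hMc : Continuous M := M.continuous
  have hevc : ∀ p : MvPolynomial (Fin 2) ℝ, Continuous fun x => eval x p :=
    fun p => MvPolynomial.continuous_eval p
  let f : (Fin 2 → ℝ) × (Fin 2 → ℝ) × (Fin 2 → ℝ) → Fin 2 → Polynomial ℝ := fun e l =>
    Polynomial.C (e.2.1 l - e.1 l) * Polynomial.X + Polynomial.C (e.1 l)
  have hfe : ∀ e t, (fun l => (f e l).eval t) = edgePt e t := by
    intro e t; ext l; simp [f, edgePt]; ring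
  have hfd : ∀ e l, (f e l).natDegree ≤ 1 := fun e l => Polynomial.natDegree_linear_le
  have hMe : ∀ (e : (Fin 2 → ℝ) × (Fin 2 → ℝ) × (Fin 2 → ℝ)) (t : ℝ),
      M (M.symm e.1 + t • (M.symm e.2.1 - M.symm e.1)) = edgePt e t := by
    intro e t; simp [edgePt]
  have hfrS : frontier (M ⁻¹' P.T) = M ⁻¹' (frontier P.T) :=
    (M.toHomeomorph.preimage_frontier P.T).symm
  have hclS : closure (M ⁻¹' P.T) = M ⁻¹' (closure P.T) :=
    (M.toHomeomorph.preimage_closure P.T).symm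
  have hdiv := plane_int k (M ⁻¹' P.T) (P.open_T.preimage hMc)
    (P.convex_T.linear_preimage M.toLinearEquiv.toLinearMap)
    (P.nonempty_T.preimage M.surjective)
    (by
      have : M ⁻¹' P.T = M.symm '' P.T := by
        ext z; constructor
        · intro hz; exact ⟨M z, hz, M.symm_apply_apply z⟩
        · rintro ⟨x, hx, rfl⟩; simpa using hx
      rw [this]
      exact M.symm.lipschitz.isBounded_image P.bounded_T)
    P.edges (fun e => M.symm e.1) (fun e => M.symm e.2.1) (fun e => (e.2.2 j, e.2.2 i))
    (fun e => aeval (f e) u) (fun e => aeval (f e) (pderiv i u))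
    (fun z => eval (M z) u) (fun z => eval (M z) (pderiv i u))
    (by
      intro z hz
      rw [hfrS] at hz
      have hz' : M z ∈ frontier P.T := hz
      rw [P.frontier_eq] at hz'
      simp only [Set.mem_iUnion, segment_eq_image'] at hz'
      obtain ⟨e, he, t, ht, hzt⟩ := hz'
      refine ⟨e, he, t, ht, ?_⟩
      apply M.injective
      rw [hMe, ← hzt]; rfl)
    (by
      intro e he t ht
      rw [hclS]
      rw [Set.mem_preimage]
      rw [hMe]
      apply frontier_subset_closure
      rw [P.frontier_eq]
      simp only [Set.mem_iUnion, segment_eq_image']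
      exact ⟨e, he, t, ht, rfl⟩)
    (fun e he h => P.edge_ne e he (M.symm.injective h))
    (by
      intro e he
      have := P.normal_orth e he
      rw [hij] at this
      simpa [hs1, hs2] using this)
    (by
      intro e he z hz
      have := strict_outward P e he (M z) hz
      rw [hij, hMi, hMj] at this
      simpa [hs1, hs2] using this)
    (by intro e he t; rw [hMe, eval_aeval_poly, hfe])
    (by intro e he t; rw [hMe, eval_aeval_poly, hfe])
    (by
      intro e he
      simpa using aeval_natDegree_le u hdeg (f e) (hfd e))
    (by
      intro e he
      simpa using aeval_natDegree_le (pderiv i u) hd1 (f e) (hfd e))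
    (by
      intro e he q hq
      simp only [eval_aeval_poly, hfe]
      exact hQb e he q hq)
    (fun z => eval (M z) (pderiv i u * pderiv i u + u * pderiv i (pderiv i u)))
    ((hevc _).comp hMc)
    (by
      intro x y
      have hv : ∀ l, HasDerivAt (fun y => M (x, y) l) (if l = i then 1 else 0) y := by
        intro l
        by_cases hl : l = i
        · subst hl
          simp only [hMi, if_true]
          exact hasDerivAt_id' y
        · rw [hne l hl]
          simpa [hMj, hji] using hasDerivAt_const y x
      have := (hasDerivAt_eval i u (fun y => M (x, y)) y hv).mul
        (hasDerivAt_eval i (pderiv i u) (fun y => M (x, y)) y hv)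
      simp only [map_add, map_mul]
      exact this)
  have hme : MeasurableEmbedding M := M.toHomeomorph.measurableEmbedding
  rw [hM.setIntegral_preimage_emb hme
    (fun x => eval x (pderiv i u * pderiv i u + u * pderiv i (pderiv i u)))] at hdiv
  have hintg : ∀ p : MvPolynomial (Fin 2) ℝ, IntegrableOn (fun x => eval x p) P.T := fun p =>
    ((hevc p).continuousOn.integrableOn_compact P.bounded_T.isCompact_closure).mono_set
      subset_closure
  simp only [map_add] at hdiv
  rw [integral_add (hintg _) (hintg _)] at hdiv
  have h0 := hQ0 _ hd2
  simp only [map_mul] at hdiv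
  rw [h0, add_zero] at hdiv
  apply eq_zero_of_open P.T P.open_T P.nonempty_T
  intro x hx
  by_contra hc
  have hcont : Continuous fun x => eval x (pderiv i u) * eval x (pderiv i u) :=
    (hevc _).mul (hevc _)
  have hI : IntegrableOn (fun x => eval x (pderiv i u) * eval x (pderiv i u)) P.T := by
    simpa using hintg (pderiv i u * pderiv i u)
  have hpos : 0 < ∫ x in P.T, eval x (pderiv i u) * eval x (pderiv i u) := by
    rw [setIntegral_pos_iff_support_of_nonneg_ae
      (Filter.Eventually.of_forall fun x => mul_self_nonneg _) hI]
    apply IsOpen.measure_pos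
    · exact (hcont.isOpen_support).inter P.open_T
    · exact ⟨x, by simpa using hc, hx⟩
  linarith

/-- If `u ∈ P_{k+2}(T)` has vanishing `L²(T)`-projection onto `P_k(T)`
(equivalently, `u ⟂ P_k(T)` in `L²(T)`) and vanishing `L²(e)`-projection onto
`P_{k+1}(e)` on every edge `e` of `∂T` (equivalently, `u|_e ⟂ P_{k+1}(e)`),
then `u = 0`. -/
theorem projection_injective (k : ℕ) (P : ConvexPolygon2)
    (u : MvPolynomial (Fin 2) ℝ) (hdeg : u.totalDegree ≤ k + 2)
    (hQ0 : ∀ p : MvPolynomial (Fin 2) ℝ, p.totalDegree ≤ k →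
      ∫ x in P.T, eval x u * eval x p = 0)
    (hQb : ∀ e ∈ P.edges, ∀ q : Polynomial ℝ, q.natDegree ≤ k + 1 →
      ∫ t in (0:ℝ)..1, eval (edgePt e t) u * q.eval t = 0) :
    u = 0 := by
  have h1 : pderiv 1 u = 0 :=
    dir_zero k P u hdeg hQ0 hQb 1 0 (fun f => Fin.sum_univ_two f) (by decide) (by decide)
      (ContinuousLinearEquiv.finTwoArrow ℝ ℝ).symm
      (volume_preserving_finTwoArrow ℝ).symm (fun z => rfl) (fun z => rfl)
  have h0 : pderiv 0 u = 0 :=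
    dir_zero k P u hdeg hQ0 hQb 0 1 (fun f => by rw [Fin.sum_univ_two, add_comm]) (by decide)
      (by decide) ((ContinuousLinearEquiv.prodComm ℝ ℝ ℝ).trans
        (ContinuousLinearEquiv.finTwoArrow ℝ ℝ).symm)
      ((volume_preserving_finTwoArrow ℝ).symm.comp
        (Measure.measurePreserving_swap (μ := (volume : Measure ℝ)) (ν := (volume : Measure ℝ))))
      (fun z => rfl) (fun z => rfl)
  have hu := eq_C_of_pderiv u (Fin.forall_fin_two.2 ⟨h0, h1⟩)
  have hone := hQ0 1 (by simp)
  rw [hu] at hone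
  simp only [eval_C, map_one, mul_one, setIntegral_const, smul_eq_mul] at hone
  have hvol : volume.real P.T ≠ 0 := by
    rw [Measure.real, ENNReal.toReal_ne_zero]
    exact ⟨(P.open_T.measure_pos volume P.nonempty_T).ne', P.bounded_T.measure_lt_top.ne⟩
  rw [hu, (mul_eq_zero.1 hone).resolve_left hvol, C_0]
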